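/- arXiv:2404.16324 — 2 statements merged into one kernel-verified Lean document; each statement's English description precedes it below -/
import Mathlib

section
/- Let K : (P → ℝ) → (Fin M → ℝ) be a linear map and let y = K x† for some x† : P → ℝ. Let {δ_k} ⊂ (0,∞) with δ_k → 0, and let y^{δ_k} ∈ (Fin M → ℝ) satisfy ‖y^{δ_k} − y‖₂ ≤ δ_k for all k. Let α : (0,∞) → (0,∞) satisfy α(δ_k) → 0 and δ_k²/α(δ_k) → 0 as k → ∞. Let x₀^{(k)} : P → ℝ be a sequence converging to x₀ : P → ℝ, and assume ker K ∩ ker Δ_{x₀} = {0}. For each k let x_k be a minimizer over x : P → ℝ of the functional x ↦ (1/2)‖Kx − y^{δ_k}‖₂² + α(δ_k)‖Δ_{x₀^{(k)}} x‖₁. Then the sequence {x_k} has a convergent subsequence, and the limit x̄ of every convergent subsequence is a graph-minimizing solution with respect to x₀, i.e. K x̄ = y and ‖Δ_{x₀} x̄‖₁ = min{ ‖Δ_{x₀} x‖₁ : x : P → ℝ, Kx = y }. Moreover, if the graph-minimizing solution with respect to x₀ is unique, then the whole sequence x_k converges to it. -/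
open Finset Filter Topology

/-- ℓ¹ distance between two pixels on the grid `Fin n × Fin m`. -/
def dist1 {n m : ℕ} (p q : Fin n × Fin m) : ℕ :=
  ((p.1 : ℤ) - (q.1 : ℤ)).natAbs + ((p.2 : ℤ) - (q.2 : ℤ)).natAbs

/-- Edge-weight function `w_u` built from the image `u`, with parameters `σ` and `R`. -/
noncomputable def wgt {n m : ℕ} (σ R : ℝ) (u : Fin n × Fin m → ℝ)
    (p q : Fin n × Fin m) : ℝ :=
  if 0 < dist1 p q ∧ (dist1 p q : ℝ) ≤ R then Real.exp (-(u p - u q) ^ 2 / σ) else 0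

/-- Graph Laplacian `Δ_u` applied to `z`. -/
noncomputable def lap {n m : ℕ} (σ R : ℝ) (u z : Fin n × Fin m → ℝ)
    (p : Fin n × Fin m) : ℝ :=
  ∑ q, wgt σ R u p q * (z p - z q)

/-- ℓ¹ norm on the pixel grid. -/
noncomputable def norm1 {n m : ℕ} (z : Fin n × Fin m → ℝ) : ℝ := ∑ p, |z p|

/-- Euclidean norm on `Fin M → ℝ`. -/
noncomputable def norm2 {M : ℕ} (v : Fin M → ℝ) : ℝ := Real.sqrt (∑ i, (v i) ^ 2)

/-- Euclidean norm on the pixel grid. -/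
noncomputable def norm2P {n m : ℕ} (z : Fin n × Fin m → ℝ) : ℝ :=
  Real.sqrt (∑ p, (z p) ^ 2)

section GraphLaplacian

variable {n m : ℕ}

theorem continuous_norm1 : Continuous (norm1 : (Fin n × Fin m → ℝ) → ℝ) := by
  unfold norm1
  fun_prop

theorem norm1_nonneg (z : Fin n × Fin m → ℝ) : 0 ≤ norm1 z :=
  Finset.sum_nonneg fun _ _ => abs_nonneg _

theorem norm1_smul (c : ℝ) (z : Fin n × Fin m → ℝ) : norm1 (c • z) = |c| * norm1 z := by
  simp [norm1, abs_mul, Finset.mul_sum]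

theorem eq_zero_of_norm1_eq_zero {z : Fin n × Fin m → ℝ} (h : norm1 z = 0) : z = 0 := by
  funext p
  have := (Finset.sum_eq_zero_iff_of_nonneg fun p _ => abs_nonneg (z p)).1 h p (Finset.mem_univ p)
  simpa using this

theorem continuous_wgt (σ R : ℝ) (p q : Fin n × Fin m) :
    Continuous fun u : Fin n × Fin m → ℝ => wgt σ R u p q := by
  unfold wgt
  split_ifs <;> fun_prop

theorem continuous_lap (σ R : ℝ) :
    Continuous fun a : (Fin n × Fin m → ℝ) × (Fin n × Fin m → ℝ) => lap σ R a.1 a.2 := by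
  unfold lap
  refine continuous_pi fun p => continuous_finsetSum _ fun q _ => ?_
  exact ((continuous_wgt σ R p q).comp continuous_fst).mul (by fun_prop)

theorem lap_smul (σ R c : ℝ) (u z : Fin n × Fin m → ℝ) :
    lap σ R u (c • z) = c • lap σ R u z := by
  funext p
  simp only [lap, Pi.smul_apply, smul_eq_mul, Finset.mul_sum]
  exact Finset.sum_congr rfl fun q _ => by ring

theorem tendsto_norm1_lap {ι : Type*} {l : Filter ι} (σ R : ℝ)
    {u z : ι → Fin n × Fin m → ℝ} {u₀ z₀ : Fin n × Fin m → ℝ}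
    (hu : Tendsto u l (𝓝 u₀)) (hz : Tendsto z l (𝓝 z₀)) :
    Tendsto (fun i => norm1 (lap σ R (u i) (z i))) l (𝓝 (norm1 (lap σ R u₀ z₀))) := by
  have h := ((continuous_lap σ R).tendsto (u₀, z₀)).comp (hu.prodMk_nhds hz)
  simp only [Function.comp_def] at h
  exact (continuous_norm1.tendsto _).comp h

/-- If `ker K ∩ ker Δ_{u₀} = {0}`, then `‖K z‖ + ‖Δ_u z‖₁` is coercive in `z`, uniformly for `u`
near `u₀`. -/
theorem exists_eventually_coercive {M : ℕ} (σ R : ℝ)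
    (K : (Fin n × Fin m → ℝ) →ₗ[ℝ] (Fin M → ℝ)) (u₀ : Fin n × Fin m → ℝ)
    (hker : ∀ z, K z = 0 → lap σ R u₀ z = 0 → z = 0) :
    ∃ c > 0, ∀ᶠ u in 𝓝 u₀, ∀ z, c * ‖z‖ ≤ ‖K z‖ + norm1 (lap σ R u z) := by
  have hK : Continuous K := K.continuous_of_finiteDimensional
  let F : (Fin n × Fin m → ℝ) × (Fin n × Fin m → ℝ) → ℝ :=
    fun a => ‖K a.2‖ + norm1 (lap σ R a.1 a.2)
  have hF : Continuous F := by
    have := continuous_norm1.comp (continuous_lap (n := n) (m := m) σ R)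
    exact (hK.comp continuous_snd).norm.add this
  have hS : IsCompact (Metric.sphere (0 : Fin n × Fin m → ℝ) 1) := isCompact_sphere 0 1
  have hpos : ∀ z ∈ Metric.sphere (0 : Fin n × Fin m → ℝ) 1, 0 < F (u₀, z) := by
    intro z hz
    have h1 := norm_nonneg (K z)
    have h2 := norm1_nonneg (lap σ R u₀ z)
    refine lt_of_le_of_ne (add_nonneg h1 h2) fun h => ?_
    change 0 = ‖K z‖ + norm1 (lap σ R u₀ z) at h
    have h0 : z = 0 := hker z (norm_eq_zero.1 (by linarith))
      (eq_zero_of_norm1_eq_zero (by linarith))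
    simp [h0] at hz
  obtain ⟨c, hc, hcF⟩ : ∃ c > 0, ∀ z ∈ Metric.sphere (0 : Fin n × Fin m → ℝ) 1,
      c < F (u₀, z) := by
    rcases (Metric.sphere (0 : Fin n × Fin m → ℝ) 1).eq_empty_or_nonempty with he | hne
    · exact ⟨1, one_pos, by simp [he]⟩
    · obtain ⟨z, hz, hmin⟩ := hS.exists_isMinOn hne
        (f := fun z => F (u₀, z)) (by fun_prop)
      exact ⟨F (u₀, z) / 2, half_pos (hpos z hz),
        fun w hw => (half_lt_self (hpos z hz)).trans_le (hmin hw)⟩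
  refine ⟨c, hc, ?_⟩
  have hev : ∀ᶠ u in 𝓝 u₀, ∀ z ∈ Metric.sphere (0 : Fin n × Fin m → ℝ) 1, c < F (u, z) :=
    hS.eventually_forall_of_forall_eventually fun z hz =>
      (hF.tendsto (u₀, z)).eventually_const_lt (hcF z hz)
  filter_upwards [hev] with u hu z
  rcases eq_or_ne z 0 with rfl | hz
  · simpa using norm1_nonneg _
  · have hz' : 0 < ‖z‖ := norm_pos_iff.2 hz
    have h := hu (‖z‖⁻¹ • z) (by simp [norm_smul, hz'.ne'])
    simp only [F, map_smul, lap_smul, norm1_smul, norm_smul, norm_inv, norm_norm,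
      abs_inv, abs_norm, ← mul_add] at h
    rw [← div_eq_inv_mul, lt_div_iff₀ hz'] at h
    exact h.le

end GraphLaplacian

theorem abs_le_norm2 {M : ℕ} (v : Fin M → ℝ) (i : Fin M) : |v i| ≤ norm2 v :=
  Real.abs_le_sqrt
    (Finset.single_le_sum (f := fun i => (v i) ^ 2) (fun _ _ => sq_nonneg _) (Finset.mem_univ i))

theorem norm2_nonneg {M : ℕ} (v : Fin M → ℝ) : 0 ≤ norm2 v := Real.sqrt_nonneg _

theorem tendsto_of_norm2_sub_tendsto_zero {ι : Type*} {l : Filter ι} {M : ℕ}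
    {v w : ι → Fin M → ℝ} {y : Fin M → ℝ}
    (hv : Tendsto (fun k => norm2 (fun i => v k i - w k i)) l (𝓝 0))
    (hw : Tendsto w l (𝓝 y)) : Tendsto v l (𝓝 y) := by
  have h : Tendsto (fun k => v k - w k) l (𝓝 0) :=
    tendsto_pi_nhds.2 fun i => squeeze_zero_norm (fun k => abs_le_norm2 _ i) hv
  simpa using h.add hw

theorem norm2_sub_comm {M : ℕ} (v w : Fin M → ℝ) :
    norm2 (fun i => v i - w i) = norm2 (fun i => w i - v i) := by
  simp only [norm2]
  congr 1
  exact Finset.sum_congr rfl fun i _ => by ring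

/-- Convergence of the graphLaΨ method (Theorem on convergence of minimizers):
subsequential convergence, every limit point is a graph-minimizing solution w.r.t. `x₀`,
and full convergence under uniqueness. -/
theorem graphLa_convergence
    (n m M : ℕ) (hn : 1 ≤ n) (hm : 1 ≤ m)
    (σ R : ℝ) (hσ : 0 < σ) (hR : 0 < R)
    (K : (Fin n × Fin m → ℝ) →ₗ[ℝ] (Fin M → ℝ))
    (xdag : Fin n × Fin m → ℝ) (y : Fin M → ℝ) (hy : y = K xdag)
    (δ : ℕ → ℝ) (hδpos : ∀ k, 0 < δ k)
    (hδ0 : Tendsto δ atTop (𝓝 0))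
    (yδ : ℕ → Fin M → ℝ) (hyδ : ∀ k, norm2 (fun i => yδ k i - y i) ≤ δ k)
    (α : ℝ → ℝ) (hαpos : ∀ t, 0 < t → 0 < α t)
    (hα0 : Tendsto (fun k => α (δ k)) atTop (𝓝 0))
    (hδα : Tendsto (fun k => (δ k) ^ 2 / α (δ k)) atTop (𝓝 0))
    (x0seq : ℕ → Fin n × Fin m → ℝ) (x0 : Fin n × Fin m → ℝ)
    (hx0 : Tendsto x0seq atTop (𝓝 x0))
    (hker : ∀ x : Fin n × Fin m → ℝ, K x = 0 → lap σ R x0 x = 0 → x = 0)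
    (xk : ℕ → Fin n × Fin m → ℝ)
    (hmin : ∀ k, ∀ x : Fin n × Fin m → ℝ,
      (1 / 2) * (norm2 (fun i => K (xk k) i - yδ k i)) ^ 2
          + α (δ k) * norm1 (lap σ R (x0seq k) (xk k))
        ≤ (1 / 2) * (norm2 (fun i => K x i - yδ k i)) ^ 2
          + α (δ k) * norm1 (lap σ R (x0seq k) x)) :
    (∃ (φ : ℕ → ℕ) (xbar : Fin n × Fin m → ℝ), StrictMono φ ∧
        Tendsto (fun k => xk (φ k)) atTop (𝓝 xbar)) ∧
    (∀ (φ : ℕ → ℕ) (xbar : Fin n × Fin m → ℝ), StrictMono φ →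
        Tendsto (fun k => xk (φ k)) atTop (𝓝 xbar) →
        K xbar = y ∧
          ∀ x : Fin n × Fin m → ℝ, K x = y →
            norm1 (lap σ R x0 xbar) ≤ norm1 (lap σ R x0 x)) ∧
    (∀ xbar : Fin n × Fin m → ℝ,
        (K xbar = y ∧
          ∀ x : Fin n × Fin m → ℝ, K x = y →
            norm1 (lap σ R x0 xbar) ≤ norm1 (lap σ R x0 x)) →
        (∀ x' : Fin n × Fin m → ℝ,
          (K x' = y ∧
            ∀ x : Fin n × Fin m → ℝ, K x = y →
              norm1 (lap σ R x0 x') ≤ norm1 (lap σ R x0 x)) → x' = xbar) →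
        Tendsto xk atTop (𝓝 xbar)) := by
  have hbound : ∀ x, K x = y → ∀ k,
      (1 / 2) * (norm2 (fun i => K (xk k) i - yδ k i)) ^ 2
        + α (δ k) * norm1 (lap σ R (x0seq k) (xk k))
      ≤ (1 / 2) * (δ k) ^ 2 + α (δ k) * norm1 (lap σ R (x0seq k) x) := by
    intro x hx k
    refine (hmin k x).trans ?_
    have := pow_le_pow_left₀ (norm2_nonneg _) (hyδ k) 2
    rw [hx, norm2_sub_comm]
    linarith
  have hres : ∀ x, K x = y → ∀ k, norm2 (fun i => K (xk k) i - yδ k i) ≤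
      Real.sqrt ((δ k) ^ 2 + 2 * (α (δ k) * norm1 (lap σ R (x0seq k) x))) := by
    intro x hx k
    refine Real.le_sqrt_of_sq_le ?_
    have := mul_nonneg (hαpos _ (hδpos k)).le (norm1_nonneg (lap σ R (x0seq k) (xk k)))
    linarith [hbound x hx k]
  have hreg : ∀ x, K x = y → ∀ k, norm1 (lap σ R (x0seq k) (xk k)) ≤
      (1 / 2) * ((δ k) ^ 2 / α (δ k)) + norm1 (lap σ R (x0seq k) x) := by
    intro x hx k
    have ha := hαpos _ (hδpos k)
    refine le_of_mul_le_mul_left ?_ ha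
    have he : α (δ k) * ((1 / 2) * ((δ k) ^ 2 / α (δ k)) + norm1 (lap σ R (x0seq k) x))
        = (1 / 2) * (δ k) ^ 2 + α (δ k) * norm1 (lap σ R (x0seq k) x) := by
      field_simp
    rw [he]
    linarith [hbound x hx k, sq_nonneg (norm2 (fun i => K (xk k) i - yδ k i))]
  have hlap : ∀ x, Tendsto (fun k => norm1 (lap σ R (x0seq k) x)) atTop
      (𝓝 (norm1 (lap σ R x0 x))) :=
    fun x => tendsto_norm1_lap σ R hx0 tendsto_const_nhds
  have hub : ∀ x, Tendsto
      (fun k => (1 / 2) * ((δ k) ^ 2 / α (δ k)) + norm1 (lap σ R (x0seq k) x)) atTop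
      (𝓝 (norm1 (lap σ R x0 x))) := fun x => by
    simpa only [mul_zero, zero_add] using (hδα.const_mul (1 / 2)).add (hlap x)
  have hyδlim : Tendsto yδ atTop (𝓝 y) :=
    tendsto_of_norm2_sub_tendsto_zero
      (squeeze_zero (fun k => norm2_nonneg _) hyδ hδ0) tendsto_const_nhds
  have hKlim : Tendsto (fun k => K (xk k)) atTop (𝓝 y) := by
    refine tendsto_of_norm2_sub_tendsto_zero
      (squeeze_zero (fun k => norm2_nonneg _) (hres xdag hy.symm) ?_) hyδlim
    have h := ((hδ0.pow 2).add ((hα0.mul (hlap xdag)).const_mul 2)).sqrt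
    simpa using h
  have hbdd : ∃ B, ∀ᶠ k in atTop, ‖xk k‖ ≤ B := by
    obtain ⟨c, hc, hcoer⟩ := exists_eventually_coercive σ R K x0 hker
    refine ⟨(‖y‖ + 1 + (norm1 (lap σ R x0 xdag) + 1)) / c, ?_⟩
    filter_upwards [hx0.eventually hcoer,
      hKlim.norm.eventually_le_const (lt_add_one _),
      (hub xdag).eventually_le_const (lt_add_one _)] with k h1 h2 h3
    rw [le_div_iff₀ hc, mul_comm]
    linarith [h1 (xk k), hreg xdag hy.symm k]
  have hsub : ∀ φ : ℕ → ℕ, Tendsto φ atTop atTop → ∃ (ψ : ℕ → ℕ) (xbar : Fin n × Fin m → ℝ),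
      StrictMono ψ ∧ Tendsto (fun k => xk (φ (ψ k))) atTop (𝓝 xbar) := by
    intro φ hφ
    obtain ⟨B, hB⟩ := hbdd
    obtain ⟨a, -, ψ, hψ, hlim⟩ := tendsto_subseq_of_frequently_bounded
      (Metric.isBounded_closedBall (x := (0 : Fin n × Fin m → ℝ)) (r := B))
      (x := fun k => xk (φ k))
      ((hφ.eventually hB).mono fun k hk => by simpa using hk).frequently
    exact ⟨ψ, a, hψ, hlim⟩
  have hlimit : ∀ (φ : ℕ → ℕ) (xbar : Fin n × Fin m → ℝ), Tendsto φ atTop atTop →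
      Tendsto (fun k => xk (φ k)) atTop (𝓝 xbar) →
      K xbar = y ∧ ∀ x : Fin n × Fin m → ℝ, K x = y →
        norm1 (lap σ R x0 xbar) ≤ norm1 (lap σ R x0 x) := by
    intro φ xbar hφ hlim
    refine ⟨tendsto_nhds_unique
      ((K.continuous_of_finiteDimensional.tendsto xbar).comp hlim) (hKlim.comp hφ), ?_⟩
    intro x hx
    exact le_of_tendsto_of_tendsto' (tendsto_norm1_lap σ R (hx0.comp hφ) hlim)
      ((hub x).comp hφ) fun k => hreg x hx (φ k)
  refine ⟨?_, fun φ xbar hφ => hlimit φ xbar hφ.tendsto_atTop, ?_⟩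
  · obtain ⟨ψ, xbar, hψ, hlim⟩ := hsub id tendsto_id
    exact ⟨ψ, xbar, hψ, hlim⟩
  · intro xbar _ huniq
    refine tendsto_of_subseq_tendsto fun φ hφ => ?_
    obtain ⟨ψ, x', hψ, hlim⟩ := hsub φ hφ
    have hx' := huniq x' (hlimit (φ ∘ ψ) x' (hφ.comp hψ.tendsto_atTop) hlim)
    exact ⟨ψ, hx' ▸ hlim⟩
end

section
/- Let K : (P → ℝ) → (Fin M → ℝ) be a linear map, u : P → ℝ, α > 0, and y^δ ∈ (Fin M → ℝ). If ker K ∩ ker Δ_u = {0}, then the functional F(x) = (1/2)‖Kx − y^δ‖₂² + α‖Δ_u x‖₁ is coercive (F(x) → ∞ as ‖x‖₂ → ∞) and attains its minimum over x : P → ℝ. -/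
open Finset Filter Topology

/-- The graph Laplacian as a linear map. -/
noncomputable def lapLinear {n m : ℕ} (σ R : ℝ) (u : Fin n × Fin m → ℝ) :
    (Fin n × Fin m → ℝ) →ₗ[ℝ] (Fin n × Fin m → ℝ) where
  toFun := lap σ R u
  map_add' x y := by
    ext p
    simp only [lap, Pi.add_apply, ← Finset.sum_add_distrib]
    exact Finset.sum_congr rfl fun q _ => by ring
  map_smul' c x := by
    ext p
    simp only [lap, Pi.smul_apply, smul_eq_mul, RingHom.id_apply, Finset.mul_sum]
    exact Finset.sum_congr rfl fun q _ => by ring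

theorem norm_le_norm2 {M : ℕ} (v : Fin M → ℝ) : ‖v‖ ≤ norm2 v :=
  (pi_norm_le_iff_of_nonneg (Real.sqrt_nonneg _)).2 fun i =>
    Real.abs_le_sqrt (Finset.single_le_sum (f := fun i => v i ^ 2)
      (fun _ _ => sq_nonneg _) (Finset.mem_univ i))

theorem norm_le_norm1 {n m : ℕ} (z : Fin n × Fin m → ℝ) : ‖z‖ ≤ norm1 z :=
  (pi_norm_le_iff_of_nonneg (Finset.sum_nonneg fun _ _ => abs_nonneg _)).2 fun p =>
    Finset.single_le_sum (f := fun p => |z p|) (fun _ _ => abs_nonneg _) (Finset.mem_univ p)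

theorem norm2P_le {n m : ℕ} (z : Fin n × Fin m → ℝ) :
    norm2P z ≤ √(n * m : ℝ) * ‖z‖ := by
  rw [norm2P, ← Real.sqrt_sq (norm_nonneg z), ← Real.sqrt_mul (by positivity)]
  refine Real.sqrt_le_sqrt ?_
  have h : ∀ p ∈ Finset.univ, z p ^ 2 ≤ ‖z‖ ^ 2 := fun p _ =>
    sq_le_sq' (neg_le_of_abs_le (norm_le_pi_norm z p)) (le_of_abs_le (norm_le_pi_norm z p))
  simpa using Finset.sum_le_card_nsmul _ _ _ h

/-- If `K` and `L` have trivially intersecting kernels, their joint image controls the norm. -/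
theorem exists_norm_le_mul_add {E F G : Type*} [NormedAddCommGroup E] [NormedSpace ℝ E]
    [FiniteDimensional ℝ E] [NormedAddCommGroup F] [NormedSpace ℝ F]
    [NormedAddCommGroup G] [NormedSpace ℝ G] (K : E →ₗ[ℝ] F) (L : E →ₗ[ℝ] G)
    (h : ∀ x, K x = 0 → L x = 0 → x = 0) :
    ∃ c : ℝ, 0 < c ∧ ∀ x, ‖x‖ ≤ c * (‖K x‖ + ‖L x‖) := by
  have hT : LinearMap.ker (K.prod L) = ⊥ :=
    LinearMap.ker_eq_bot'.2 fun x hx => h x (congrArg Prod.fst hx) (congrArg Prod.snd hx)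
  obtain ⟨c, hc, hanti⟩ := (K.prod L).exists_antilipschitzWith hT
  refine ⟨c, hc, fun x => ?_⟩
  have hx := hanti.le_mul_dist x 0
  rw [map_zero, dist_zero_right, dist_zero_right] at hx
  refine hx.trans (mul_le_mul_of_nonneg_left ?_ c.2)
  exact max_le (le_add_of_nonneg_right (norm_nonneg _)) (le_add_of_nonneg_left (norm_nonneg _))

/-- Under the kernel condition `ker K ∩ ker Δ_u = {0}`, the graph-Tikhonov functional
is coercive and attains its minimum. -/
theorem graphLa_coercive_and_min_attained
    (n m M : ℕ) (hn : 1 ≤ n) (hm : 1 ≤ m)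
    (σ R : ℝ) (hσ : 0 < σ) (hR : 0 < R)
    (K : (Fin n × Fin m → ℝ) →ₗ[ℝ] (Fin M → ℝ))
    (u : Fin n × Fin m → ℝ) (α : ℝ) (hα : 0 < α)
    (yδ : Fin M → ℝ)
    (hker : ∀ x : Fin n × Fin m → ℝ, K x = 0 → lap σ R u x = 0 → x = 0) :
    (∀ C : ℝ, ∃ B : ℝ, ∀ x : Fin n × Fin m → ℝ, B ≤ norm2P x →
      C ≤ (1 / 2) * (norm2 (fun i => K x i - yδ i)) ^ 2 + α * norm1 (lap σ R u x)) ∧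
    (∃ xmin : Fin n × Fin m → ℝ, ∀ x : Fin n × Fin m → ℝ,
      (1 / 2) * (norm2 (fun i => K xmin i - yδ i)) ^ 2 + α * norm1 (lap σ R u xmin)
        ≤ (1 / 2) * (norm2 (fun i => K x i - yδ i)) ^ 2 + α * norm1 (lap σ R u x)) := by
  obtain ⟨c, hc, hcoer⟩ := exists_norm_le_mul_add K (lapLinear σ R u) hker
  set F : (Fin n × Fin m → ℝ) → ℝ := fun x =>
    (1 / 2) * (norm2 (fun i => K x i - yδ i)) ^ 2 + α * norm1 (lap σ R u x) with hF
  have ha : 0 < min 1 α / c := div_pos (lt_min one_pos hα) hc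
  have hlow : ∀ x, min 1 α / c * ‖x‖ - (‖yδ‖ + 1 / 2) ≤ F x := fun x => by
    have hK : ‖K x‖ ≤ norm2 (fun i => K x i - yδ i) + ‖yδ‖ :=
      (norm_le_norm_sub_add (K x) yδ).trans
        (add_le_add_left (norm_le_norm2 (fun i => K x i - yδ i)) _)
    have hL : ‖lapLinear σ R u x‖ ≤ norm1 (lap σ R u x) := norm_le_norm1 _
    have h1 : min 1 α / c * ‖x‖ ≤ min 1 α * (‖K x‖ + ‖lapLinear σ R u x‖) := by
      rw [div_mul_eq_mul_div, div_le_iff₀ hc]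
      calc min 1 α * ‖x‖ ≤ min 1 α * (c * (‖K x‖ + ‖lapLinear σ R u x‖)) :=
            mul_le_mul_of_nonneg_left (hcoer x) (lt_min one_pos hα).le
        _ = _ := by ring
    have h2 : min 1 α * ‖K x‖ ≤ 1 * ‖K x‖ :=
      mul_le_mul_of_nonneg_right (min_le_left _ _) (norm_nonneg _)
    have h3 : min 1 α * ‖lapLinear σ R u x‖ ≤ α * norm1 (lap σ R u x) :=
      mul_le_mul (min_le_right _ _) hL (norm_nonneg _) hα.le
    simp only [hF]
    nlinarith [sq_nonneg (norm2 (fun i => K x i - yδ i) - 1)]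
  have hcont : Continuous F := by
    have hKc : Continuous K := K.continuous_of_finiteDimensional
    simp only [hF, norm2, norm1, lap]
    fun_prop
  refine ⟨fun C => ?_, ?_⟩
  · set r : ℝ := (C + (‖yδ‖ + 1 / 2)) / (min 1 α / c) with hr
    refine ⟨√(n * m : ℝ) * r, fun x hx => le_trans ?_ (hlow x)⟩
    have hs : 0 < √(n * m : ℝ) := Real.sqrt_pos.2 (by positivity)
    have hrx : r ≤ ‖x‖ := le_of_mul_le_mul_left (hx.trans (norm2P_le x)) hs
    rw [hr, div_le_iff₀ ha] at hrx
    linarith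
  · refine hcont.exists_forall_le (tendsto_atTop_mono hlow ?_)
    exact tendsto_atTop_add_const_right _ _
      ((tendsto_norm_cocompact_atTop (E := Fin n × Fin m → ℝ)).const_mul_atTop ha)
end
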